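/- Let 𝔾 be a toroidal grid diagram of grid number n with 4-fold diagram 𝔾₄. For any grid states x₄, y₄ of 𝔾₄ and any [r₄] ∈ [Rect](x₄,y₄): M(x₄) − M(y₄) = 1 − 2·Σ_{i=1}^n O_i[r₄] + 2·m[r₄], and A(x₄) − A(y₄) = Σ_{i=1}^n X_i[r₄] − Σ_{i=1}^n O_i[r₄]. -/

import Mathlib

/-!
Combinatorial model of toroidal grid diagrams, their 4-fold covers, and the
double-point enhanced grid complex (over 𝔽 = ℤ/2ℤ), following Lipshitz and
Ozsváth–Szabó–Sarkar conventions.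

* The torus is modelled by `ZMod n × ZMod n`: the horizontal circle `α_j` and
  vertical circle `β_k` meet at the point `(k, j)`; the square `(k, j)` is the
  one with south-west corner at the point `(k, j)`;  the `O`- and `X`-markings
  of column `k` occupy squares `(k, Orow k)` and `(k, Xrow k)`.
* A grid state is a bijection (column ↦ row), i.e. a permutation of `ZMod n`.
* The 4-fold cover `𝔾₄` lives on `ZMod (2n) × ZMod (2n)`, with the covering
  map `pr` reducing coordinates mod `n`.  A grid state of `𝔾₄` is the preimage
  of a grid state of `𝔾`, so grid states of `𝔾₄` are canonically identified
  with grid states of `𝔾`; similarly the free module `GC` underlying both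
  `GC•(𝔾)` and `GC•(𝔾₄)` is the same, and the identification `J₄` is the
  identity map.
* Rectangles are recorded by their two vertical circles (west/east) and two
  horizontal circles (south/north); "rectangle from x₄ to y₄" is the boundary
  condition `∂(∂_α(r + Nr + Er + NEr)) = y₄ - x₄` (and the `∂_β` analogue),
  expressed via corner-point indicator functions.  Each `N,E`-equivalence class
  of rectangles in `𝔾₄` contains exactly one *normalized* representative
  (west circle and south circle in the first fundamental domain), so sums over
  equivalence classes are sums over normalized representatives.
-/

noncomputable section

open scoped Classical

namespace GridHomology

/-- the ground field `𝔽 = ℤ/2ℤ` -/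
abbrev F : Type := ZMod 2

/-- A toroidal grid diagram of grid number `n`. -/
structure GridDiagram (n : ℕ) where
  Orow : ZMod n → ZMod n
  Xrow : ZMod n → ZMod n
  hO : Function.Bijective Orow
  hX : Function.Bijective Xrow
  hOX : ∀ i, Orow i ≠ Xrow i

/-- A grid state: one point on each horizontal and each vertical circle. -/
abbrev GridState (n : ℕ) := Equiv.Perm (ZMod n)

instance twoMulNeZero (n : ℕ) [NeZero n] : NeZero (2 * n) :=
  ⟨fun h => NeZero.ne n (by omega)⟩

/-- membership in the cyclic (going east/north) interval `[u, v)` -/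
def inIco {m : ℕ} (u v k : ZMod m) : Prop := (k - u).val < (v - u).val

/-- membership in the open cyclic interval `(u, v)` -/
def inIoo {m : ℕ} (u v k : ZMod m) : Prop :=
  0 < (k - u).val ∧ (k - u).val < (v - u).val

instance {m : ℕ} (u v k : ZMod m) : Decidable (inIco u v k) :=
  inferInstanceAs (Decidable (_ < _))

instance {m : ℕ} (u v k : ZMod m) : Decidable (inIoo u v k) :=
  inferInstanceAs (Decidable (_ ∧ _))

/-- Rectangle data on the `m × m` torus: west and east vertical circles,
south and north horizontal circles. -/
structure Rect (m : ℕ) where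
  cW : ZMod m
  cE : ZMod m
  rS : ZMod m
  rN : ZMod m
deriving DecidableEq

instance (m : ℕ) [NeZero m] : Fintype (Rect m) :=
  Fintype.ofEquiv (ZMod m × ZMod m × ZMod m × ZMod m)
    { toFun := fun p => ⟨p.1, p.2.1, p.2.2.1, p.2.2.2⟩
      invFun := fun r => ⟨r.cW, r.cE, r.rS, r.rN⟩
      left_inv := fun _ => rfl
      right_inv := fun _ => rfl }

/-- local multiplicity of a rectangle at a square of the torus -/
def Rect.mult {m : ℕ} (r : Rect m) (sq : ZMod m × ZMod m) : ℕ :=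
  if inIco r.cW r.cE sq.1 ∧ inIco r.rS r.rN sq.2 then 1 else 0

/-- `r` is an (embedded, not necessarily empty) rectangle from `x` to `y` in `𝔾`:
its south-west and north-east corners lie in `x`, its south-east and north-west
corners lie in `y`, and `x`, `y` agree away from the two vertical circles of `r`. -/
def IsRectFrom {m : ℕ} (x y : GridState m) (r : Rect m) : Prop :=
  r.cW ≠ r.cE ∧ r.rS ≠ r.rN ∧
  x r.cW = r.rS ∧ x r.cE = r.rN ∧ y r.cW = r.rN ∧ y r.cE = r.rS ∧
  ∀ k, k ≠ r.cW → k ≠ r.cE → x k = y k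

/-- point-measure of a rectangle in `𝔾` at a grid state `w`: the sum over the
points of `w` of the average of the four adjacent local multiplicities -/
def Rect.pm {m : ℕ} [NeZero m] (w : GridState m) (r : Rect m) : ℚ :=
  (∑ k : ZMod m, ((r.mult (k - 1, w k - 1) + r.mult (k, w k - 1) +
      r.mult (k - 1, w k) + r.mult (k, w k) : ℕ) : ℚ)) / 4

/-- `m(r) = #(Int r ∩ x)` -/
def Rect.intCount {m : ℕ} [NeZero m] (x : GridState m) (r : Rect m) : ℕ :=
  (Finset.univ.filter fun k => inIoo r.cW r.cE k ∧ inIoo r.rS r.rN (x k)).card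

/-- `O_i(r)` in `𝔾` -/
def Ocount {m : ℕ} (G : GridDiagram m) (r : Rect m) (i : ZMod m) : ℕ :=
  r.mult (i, G.Orow i)

/-- `X_i(r)` in `𝔾` -/
def Xcount {m : ℕ} (G : GridDiagram m) (r : Rect m) (i : ZMod m) : ℕ :=
  r.mult (i, G.Xrow i)

/-- `r ∩ 𝕏 = ∅` -/
def XDisjoint {m : ℕ} (G : GridDiagram m) (r : Rect m) : Prop :=
  ∀ i, Xcount G r i = 0

/-! ### The 4-fold cover -/

/-- the covering projection `π₄ : 𝔾₄ → 𝔾` on coordinates -/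
def pr {n : ℕ} (a : ZMod (2 * n)) : ZMod n :=
  ZMod.castHom (dvd_mul_left n 2) (ZMod n) a

/-- indicator function (as a formal sum of points) of the lifted grid state `x₄` -/
def stInd {n : ℕ} (x : GridState n) (p : ZMod (2 * n) × ZMod (2 * n)) : ℤ :=
  if x (pr p.1) = pr p.2 then 1 else 0

/-- `∂(∂_α r)` as a formal sum of points: `SE + NW − SW − NE` -/
def cornerA {m : ℕ} (r : Rect m) (p : ZMod m × ZMod m) : ℤ :=
  (if p = (r.cE, r.rS) then 1 else 0) + (if p = (r.cW, r.rN) then 1 else 0)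
    - (if p = (r.cW, r.rS) then 1 else 0) - (if p = (r.cE, r.rN) then 1 else 0)

/-- `∂(∂_β r)` as a formal sum of points: `NE + SW − SE − NW` -/
def cornerB {m : ℕ} (r : Rect m) (p : ZMod m × ZMod m) : ℤ :=
  (if p = (r.cE, r.rN) then 1 else 0) + (if p = (r.cW, r.rS) then 1 else 0)
    - (if p = (r.cE, r.rS) then 1 else 0) - (if p = (r.cW, r.rN) then 1 else 0)

/-- northward translation `N` by `n` rows -/
def trN {n : ℕ} (r : Rect (2 * n)) : Rect (2 * n) :=
  ⟨r.cW, r.cE, r.rS + (n : ZMod (2 * n)), r.rN + (n : ZMod (2 * n))⟩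

/-- eastward translation `E` by `n` columns -/
def trE {n : ℕ} (r : Rect (2 * n)) : Rect (2 * n) :=
  ⟨r.cW + (n : ZMod (2 * n)), r.cE + (n : ZMod (2 * n)), r.rS, r.rN⟩

/-- `r` is a rectangle from `x₄` to `y₄` in the 4-fold diagram `𝔾₄`:
`∂(∂_α (r + Nr + Er + NEr)) = y₄ − x₄` and `∂(∂_β (r + Nr + Er + NEr)) = x₄ − y₄`. -/
def IsRect4From {n : ℕ} (x y : GridState n) (r : Rect (2 * n)) : Prop :=
  r.cW ≠ r.cE ∧ r.rS ≠ r.rN ∧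
  (∀ p, cornerA r p + cornerA (trN r) p + cornerA (trE r) p + cornerA (trN (trE r)) p
      = stInd y p - stInd x p) ∧
  (∀ p, cornerB r p + cornerB (trN r) p + cornerB (trE r) p + cornerB (trN (trE r)) p
      = stInd x p - stInd y p)

/-- the canonical (normalized) representative of each `{r, Nr, Er, NEr}`
equivalence class: west and south coordinates lie in the first fundamental domain -/
def normal4 {n : ℕ} (r : Rect (2 * n)) : Prop := r.cW.val < n ∧ r.rS.val < n

instance {n : ℕ} (r : Rect (2 * n)) : Decidable (normal4 r) :=
  inferInstanceAs (Decidable (_ ∧ _))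

/-- `O_i[r₄]`: total multiplicity of `r₄` at the four lifts of `O_i` -/
def O4count {n : ℕ} [NeZero n] (G : GridDiagram n) (r : Rect (2 * n)) (i : ZMod n) : ℕ :=
  ∑ p : ZMod (2 * n) × ZMod (2 * n),
    if pr p.1 = i ∧ pr p.2 = G.Orow i then r.mult p else 0

/-- `X_i[r₄]` -/
def X4count {n : ℕ} [NeZero n] (G : GridDiagram n) (r : Rect (2 * n)) (i : ZMod n) : ℕ :=
  ∑ p : ZMod (2 * n) × ZMod (2 * n),
    if pr p.1 = i ∧ pr p.2 = G.Xrow i then r.mult p else 0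

/-- `r₄ ∩ π₄⁻¹(𝕏) = ∅` -/
def XDisjoint4 {n : ℕ} [NeZero n] (G : GridDiagram n) (r : Rect (2 * n)) : Prop :=
  ∀ i, X4count G r i = 0

/-- point-measure of a domain (an integer-valued multiplicity function on the
squares of `𝔾₄`) at the lifted grid state `w₄` -/
def pm4 {n : ℕ} [NeZero n] (w : GridState n) (ψ : ZMod (2 * n) × ZMod (2 * n) → ℤ) : ℚ :=
  (∑ p : ZMod (2 * n) × ZMod (2 * n),
    if w (pr p.1) = pr p.2 then
      ((ψ (p.1 - 1, p.2 - 1) + ψ (p.1, p.2 - 1) + ψ (p.1 - 1, p.2) + ψ p : ℤ) : ℚ)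
    else 0) / 4

/-- a rectangle of `𝔾₄` viewed as a domain -/
def Rect.dom4 {n : ℕ} (r : Rect (2 * n)) : ZMod (2 * n) × ZMod (2 * n) → ℤ :=
  fun p => (r.mult p : ℤ)

/-- point-measure `p_{w₄}[r₄]` of a rectangle of `𝔾₄` -/
def rpm4 {n : ℕ} [NeZero n] (w : GridState n) (r : Rect (2 * n)) : ℚ :=
  pm4 w r.dom4

/-- `m[r₄] = (p_{x₄}[r₄] + p_{y₄}[r₄] − 1)/2`, as a rational number -/
def mQ4 {n : ℕ} [NeZero n] (x y : GridState n) (r : Rect (2 * n)) : ℚ :=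
  (rpm4 x r + rpm4 y r - 1) / 2

/-- `m[r₄]` as a natural number (the exponent of `v`) -/
def m4 {n : ℕ} [NeZero n] (x y : GridState n) (r : Rect (2 * n)) : ℕ :=
  (⌊mQ4 x y r⌋).toNat

/-! ### Maslov and Alexander gradings (via the planar counting function `J`) -/

/-- the points of a planar fundamental domain associated to `f`, in doubled
coordinates (grid states at even positions, markings at odd positions) -/
def ptsOf {m : ℕ} [NeZero m] (f : ZMod m → ZMod m) (off : ℕ) : Finset (ℕ × ℕ) :=
  Finset.univ.image fun k => (2 * k.val + off, 2 * (f k).val + off)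

/-- `I(P,Q)`: pairs `(p,q)` with `q` strictly above and strictly to the right of `p` -/
def Icnt (P Q : Finset (ℕ × ℕ)) : ℕ :=
  ∑ p ∈ P, (Q.filter fun q => p.1 < q.1 ∧ p.2 < q.2).card

/-- `J(P,Q) = (I(P,Q) + I(Q,P))/2` -/
def Jq (P Q : Finset (ℕ × ℕ)) : ℚ := ((Icnt P Q : ℚ) + (Icnt Q P : ℚ)) / 2

/-- the Maslov-type grading `J(x,x) − 2 J(x,P) + J(P,P) + 1` for markings `P` -/
def MaslovOf {m : ℕ} [NeZero m] (f : ZMod m → ZMod m) (x : GridState m) : ℚ :=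
  Jq (ptsOf (⇑x) 0) (ptsOf (⇑x) 0) - 2 * Jq (ptsOf (⇑x) 0) (ptsOf f 1)
    + Jq (ptsOf f 1) (ptsOf f 1) + 1

/-- the Maslov grading `M(x) = M_𝕆(x)` -/
def MaslovO {m : ℕ} [NeZero m] (G : GridDiagram m) (x : GridState m) : ℚ :=
  MaslovOf G.Orow x

/-- `M_𝕏(x)` -/
def MaslovX {m : ℕ} [NeZero m] (G : GridDiagram m) (x : GridState m) : ℚ :=
  MaslovOf G.Xrow x

/-- the Alexander grading `A(x) = (M_𝕆(x) − M_𝕏(x) − (n−1))/2` -/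
def Alex {m : ℕ} [NeZero m] (G : GridDiagram m) (x : GridState m) : ℚ :=
  (MaslovO G x - MaslovX G x - ((m : ℚ) - 1)) / 2

/-! ### The double-point enhanced grid complex -/

/-- the ring `𝔽[V₁, …, V_n, v]`: `V_i = X (some i)`, `v = X none` -/
abbrev Rng (n : ℕ) : Type := MvPolynomial (Option (ZMod n)) F

/-- the free `𝔽[V₁,…,V_n,v]`-module on the set of grid states; it underlies both
`GC•(𝔾)` and `GC•(𝔾₄)` (their grid states being canonically identified) -/
abbrev GC (n : ℕ) := GridState n →₀ Rng n

/-- the variable `V_i` -/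
def Vv {n : ℕ} (i : ZMod n) : Rng n := MvPolynomial.X (some i)

/-- the double-point variable `v` -/
def vV {n : ℕ} : Rng n := MvPolynomial.X none

/-- the `𝔽[V₁,…,V_n,v]`-linear map determined by values on grid states -/
def basisMap {n : ℕ} (f : GridState n → GC n) : GC n →ₗ[Rng n] GC n :=
  Finsupp.lsum (Rng n) fun x => LinearMap.toSpanSingleton (Rng n) (GC n) (f x)

/-- the weight `V₁^{O₁[r₄]} ⋯ V_n^{O_n[r₄]} v^{m[r₄]}` of a rectangle of `𝔾₄` -/
def wt4 {n : ℕ} [NeZero n] (G : GridDiagram n) (x y : GridState n) (r : Rect (2 * n)) :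
    Rng n :=
  (∏ i : ZMod n, Vv i ^ O4count G r i) * vV ^ m4 x y r

/-- the differential `∂₄•` of `GC•(𝔾₄)`: counts `N,E`-equivalence classes of
rectangles (via their normalized representatives) disjoint from `π₄⁻¹(𝕏)` -/
def diff4 {n : ℕ} [NeZero n] (G : GridDiagram n) : GC n →ₗ[Rng n] GC n :=
  basisMap fun x => ∑ y : GridState n,
    ∑ r ∈ Finset.univ.filter
        (fun r : Rect (2 * n) => IsRect4From x y r ∧ normal4 r ∧ XDisjoint4 G r),
      Finsupp.single y (wt4 G x y r)

/-- the weight of a rectangle of `𝔾` -/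
def wtB {n : ℕ} [NeZero n] (G : GridDiagram n) (x : GridState n) (r : Rect n) : Rng n :=
  (∏ i : ZMod n, Vv i ^ Ocount G r i) * vV ^ Rect.intCount x r

/-- the differential `∂•` of the double-point enhanced grid complex `GC•(𝔾)` -/
def diffB {n : ℕ} [NeZero n] (G : GridDiagram n) : GC n →ₗ[Rng n] GC n :=
  basisMap fun x => ∑ y : GridState n,
    ∑ r ∈ Finset.univ.filter
        (fun r : Rect n => IsRectFrom x y r ∧ XDisjoint G r),
      Finsupp.single y (wtB G x r)

/-- `z` is homogeneous of bidegree `(d, s)` for the (Maslov, Alexander) bigrading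
extended by `M(V₁^{k₁}⋯V_n^{k_n} v^m ⋅ x) = M(x) − 2Σkᵢ + 2m`,
`A(V₁^{k₁}⋯V_n^{k_n} v^m ⋅ x) = A(x) − Σkᵢ`. -/
def IsHomog {n : ℕ} [NeZero n] (G : GridDiagram n) (z : GC n) (d s : ℚ) : Prop :=
  ∀ (y : GridState n) (k : Option (ZMod n) →₀ ℕ), MvPolynomial.coeff k (z y) ≠ 0 →
    (MaslovO G y - 2 * ∑ i : ZMod n, (k (some i) : ℚ) + 2 * (k none : ℚ) = d) ∧
    (Alex G y - ∑ i : ZMod n, (k (some i) : ℚ) = s)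

/-- a linear map is homogeneous of degree `(a, b)` -/
def MapHomog {n : ℕ} [NeZero n] (G G' : GridDiagram n) (φ : GC n →ₗ[Rng n] GC n)
    (a b : ℚ) : Prop :=
  ∀ z d s, IsHomog G z d s → IsHomog G' (φ z) (d + a) (s + b)

/-- `𝔾` represents a knot: following the link (column `i` joins its `O` to the `X`
in the same row, etc.) visits every column -/
def IsKnot {n : ℕ} (G : GridDiagram n) : Prop :=
  ∀ i j : ZMod n, ∃ k : ℕ,
    (((Equiv.ofBijective G.Orow G.hO).trans (Equiv.ofBijective G.Xrow G.hX).symm) ^ k) i = j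

/-- the homotopy operator `𝓗_{X_j}•` counting equivalence classes of rectangles in
`𝔾₄` crossing the lifts of `X_j` exactly once and no other `X`-marking -/
def HXmap {n : ℕ} [NeZero n] (G : GridDiagram n) (j : ZMod n) : GC n →ₗ[Rng n] GC n :=
  basisMap fun x => ∑ y : GridState n,
    ∑ r ∈ Finset.univ.filter (fun r : Rect (2 * n) =>
        IsRect4From x y r ∧ normal4 r ∧ X4count G r j = 1 ∧
        ∀ k, k ≠ j → X4count G r k = 0),
      Finsupp.single y (wt4 G x y r)

/-! ### Commutation moves, pentagons and hexagons

`𝔾` and `𝔾'` differ by commuting the (adjacent) columns `c−1` and `c`; they are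
drawn on a common torus, sharing all markings and all circles except that the
vertical circle `β_c` of `𝔾` is replaced in `𝔾'` by a curve `γ_c` which passes
to the west of the marking line within the rows of the cyclic interval
`J = [h₁, h₂)` (which contains the markings of column `c−1`) and to the east of
it in the complementary rows (which contain the markings of column `c`);
`γ_c` crosses `β_c` at two points `a` (just south of the row-circle `h₂`) and
`b` (just south of `h₁`).  Grid states of `𝔾'` are again recorded as
permutations (the `γ`-point in row `j` replacing the `β_c`-point). -/

structure CommData (n : ℕ) where
  G : GridDiagram n
  G' : GridDiagram n
  c : ZMod n
  h₁ : ZMod n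
  h₂ : ZMod n
  hne : h₁ ≠ h₂
  hOA : inIco h₁ h₂ (G.Orow (c - 1))
  hXA : inIco h₁ h₂ (G.Xrow (c - 1))
  hOB : ¬ inIco h₁ h₂ (G.Orow c)
  hXB : ¬ inIco h₁ h₂ (G.Xrow c)
  hO'A : G'.Orow (c - 1) = G.Orow c
  hO'B : G'.Orow c = G.Orow (c - 1)
  hX'A : G'.Xrow (c - 1) = G.Xrow c
  hX'B : G'.Xrow c = G.Xrow (c - 1)
  hO' : ∀ k, k ≠ c - 1 → k ≠ c → G'.Orow k = G.Orow k
  hX' : ∀ k, k ≠ c - 1 → k ≠ c → G'.Xrow k = G.Xrow k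

/-- Pentagon data in the 4-fold torus `T₄`: the underlying rectangle
`I₄(p)` of `𝔾₄`, the side of the curved edge (`left = true` means the curved
vertical edge is the east edge of the rectangle), and the lifted height `hh`
of the crossing point (`a` or `b`) serving as the fifth corner. -/
structure Pent (n : ℕ) where
  rect : Rect (2 * n)
  left : Bool
  hh : ZMod (2 * n)
deriving DecidableEq

instance (n : ℕ) [NeZero n] : Fintype (Pent n) :=
  Fintype.ofEquiv (Rect (2 * n) × Bool × ZMod (2 * n))
    { toFun := fun p => ⟨p.1, p.2.1, p.2.2⟩
      invFun := fun p => ⟨p.rect, p.left, p.hh⟩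
      left_inv := fun _ => rfl
      right_inv := fun _ => rfl }

/-- the distinguished vertical edge lies on a lift of the curved circle -/
def onCedge {n : ℕ} (C : CommData n) (p : Pent n) : Prop :=
  if p.left then pr p.rect.cE = C.c else pr p.rect.cW = C.c

/-- the crossing point (at height just below the row circle `h`) lies strictly
inside the vertical extent of the rectangle -/
def heightOK {n : ℕ} (r : Rect (2 * n)) (h : ZMod (2 * n)) : Prop :=
  0 < (h - r.rS).val ∧ (h - r.rS).val ≤ (r.rN - r.rS).val

/-- a pentagon from `x₄ ∈ S₄(𝔾₄)` to `y₄' ∈ S₄(𝔾₄')` (with fifth corner at a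
lift of the distinguished point `a`) -/
def IsPentA {n : ℕ} (C : CommData n) (x y' : GridState n) (p : Pent n) : Prop :=
  IsRect4From x y' p.rect ∧ pr p.hh = C.h₂ ∧ onCedge C p ∧ heightOK p.rect p.hh

/-- a pentagon from `y₄' ∈ S₄(𝔾₄')` to `x₄ ∈ S₄(𝔾₄)` (fifth corner at a lift of `b`) -/
def IsPentB {n : ℕ} (C : CommData n) (y' x : GridState n) (p : Pent n) : Prop :=
  IsRect4From y' x p.rect ∧ pr p.hh = C.h₁ ∧ onCedge C p ∧ heightOK p.rect p.hh

/-- the rows along which the boundary of the pentagon runs along `γ` rather than `β_c` -/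
def detourA {n : ℕ} [NeZero n] (p : Pent n) : Finset (ZMod (2 * n)) :=
  if p.left then Finset.univ.filter (fun j => inIco p.rect.rS p.hh j)
  else Finset.univ.filter (fun j => inIco p.hh p.rect.rN j)

def detourB {n : ℕ} [NeZero n] (p : Pent n) : Finset (ZMod (2 * n)) :=
  if p.left then Finset.univ.filter (fun j => inIco p.hh p.rect.rN j)
  else Finset.univ.filter (fun j => inIco p.rect.rS p.hh j)

/-- marking-count correction along a curved edge: in a detour row `j`, if `γ` is
west (`π₄ j ∈ J`) the bigon sliver carries the column-`(c−1)` marking, otherwise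
it carries the column-`c` marking; the sliver is gained or lost according to
whether the region lies east (`east = true`) or west of the curved circle. -/
def adj {n : ℕ} [NeZero n] (C : CommData n) (f : ZMod n → ZMod n) (east : Bool)
    (D : Finset (ZMod (2 * n))) (i : ZMod n) : ℤ :=
  ∑ j ∈ D,
    if inIco C.h₁ C.h₂ (pr j) then
      (if i = C.c - 1 ∧ f (C.c - 1) = pr j then (if east then 1 else -1) else 0)
    else
      (if i = C.c ∧ f C.c = pr j then (if east then -1 else 1) else 0)

/-- `O_i[p₄]` for a pentagon counted by `P•` -/
def pentOA {n : ℕ} [NeZero n] (C : CommData n) (p : Pent n) (i : ZMod n) : ℤ :=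
  (O4count C.G p.rect i : ℤ) + adj C C.G.Orow (!p.left) (detourA p) i

def pentXA {n : ℕ} [NeZero n] (C : CommData n) (p : Pent n) (i : ZMod n) : ℤ :=
  (X4count C.G p.rect i : ℤ) + adj C C.G.Xrow (!p.left) (detourA p) i

def pentXDisjA {n : ℕ} [NeZero n] (C : CommData n) (p : Pent n) : Prop :=
  ∀ i, pentXA C p i = 0

def pentOB {n : ℕ} [NeZero n] (C : CommData n) (p : Pent n) (i : ZMod n) : ℤ :=
  (O4count C.G p.rect i : ℤ) + adj C C.G.Orow (!p.left) (detourB p) i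

def pentXB {n : ℕ} [NeZero n] (C : CommData n) (p : Pent n) (i : ZMod n) : ℤ :=
  (X4count C.G p.rect i : ℤ) + adj C C.G.Xrow (!p.left) (detourB p) i

def pentXDisjB {n : ℕ} [NeZero n] (C : CommData n) (p : Pent n) : Prop :=
  ∀ i, pentXB C p i = 0

/-- the weight `V₁^{O₁[p₄]}⋯V_n^{O_n[p₄]} v^{m[p₄]}`, with `m[p₄] = m[I₄(p₄)]` -/
def pentWtA {n : ℕ} [NeZero n] (C : CommData n) (x y' : GridState n) (p : Pent n) : Rng n :=
  (∏ i : ZMod n, Vv i ^ (pentOA C p i).toNat) * vV ^ m4 x y' p.rect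

def pentWtB {n : ℕ} [NeZero n] (C : CommData n) (y' x : GridState n) (p : Pent n) : Rng n :=
  (∏ i : ZMod n, Vv i ^ (pentOB C p i).toNat) * vV ^ m4 y' x p.rect

/-- the pentagon-counting map `P• : GC•(𝔾₄) → GC•(𝔾₄')` -/
def Pmap {n : ℕ} [NeZero n] (C : CommData n) : GC n →ₗ[Rng n] GC n :=
  basisMap fun x => ∑ y' : GridState n,
    ∑ p ∈ Finset.univ.filter (fun p : Pent n =>
        IsPentA C x y' p ∧ normal4 p.rect ∧ pentXDisjA C p),
      Finsupp.single y' (pentWtA C x y' p)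

/-- the pentagon-counting map `(P•)' : GC•(𝔾₄') → GC•(𝔾₄)` -/
def P'map {n : ℕ} [NeZero n] (C : CommData n) : GC n →ₗ[Rng n] GC n :=
  basisMap fun y' => ∑ x : GridState n,
    ∑ p ∈ Finset.univ.filter (fun p : Pent n =>
        IsPentB C y' x p ∧ normal4 p.rect ∧ pentXDisjB C p),
      Finsupp.single x (pentWtB C y' x p)

/-- Hexagon data: the underlying rectangle `I₄(h₄)` of `𝔾₄`, the side of its
curved edge, and the lifted heights of its two crossing-point corners
(`ha` a lift of `a`, `hb` a lift of `b`). -/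
structure Hex (n : ℕ) where
  rect : Rect (2 * n)
  left : Bool
  ha : ZMod (2 * n)
  hb : ZMod (2 * n)
deriving DecidableEq

instance (n : ℕ) [NeZero n] : Fintype (Hex n) :=
  Fintype.ofEquiv (Rect (2 * n) × Bool × ZMod (2 * n) × ZMod (2 * n))
    { toFun := fun p => ⟨p.1, p.2.1, p.2.2.1, p.2.2.2⟩
      invFun := fun p => ⟨p.rect, p.left, p.ha, p.hb⟩
      left_inv := fun _ => rfl
      right_inv := fun _ => rfl }

def onCedgeH {n : ℕ} (C : CommData n) (h : Hex n) : Prop :=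
  if h.left then pr h.rect.cE = C.c else pr h.rect.cW = C.c

/-- a hexagon from `x₄` to `y₄` (both states of `𝔾₄`) -/
def IsHex {n : ℕ} (C : CommData n) (x y : GridState n) (h : Hex n) : Prop :=
  IsRect4From x y h.rect ∧ pr h.ha = C.h₂ ∧ pr h.hb = C.h₁ ∧ onCedgeH C h ∧
  heightOK h.rect h.ha ∧ heightOK h.rect h.hb

/-- the rows between the two crossing-point corners of a hexagon -/
def detourH {n : ℕ} [NeZero n] (h : Hex n) : Finset (ZMod (2 * n)) :=
  if (h.ha - h.rect.rS).val < (h.hb - h.rect.rS).val then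
    Finset.univ.filter (fun j => inIco h.ha h.hb j)
  else Finset.univ.filter (fun j => inIco h.hb h.ha j)

def hexO {n : ℕ} [NeZero n] (C : CommData n) (h : Hex n) (i : ZMod n) : ℤ :=
  (O4count C.G h.rect i : ℤ) + adj C C.G.Orow (!h.left) (detourH h) i

def hexX {n : ℕ} [NeZero n] (C : CommData n) (h : Hex n) (i : ZMod n) : ℤ :=
  (X4count C.G h.rect i : ℤ) + adj C C.G.Xrow (!h.left) (detourH h) i

def hexXDisj {n : ℕ} [NeZero n] (C : CommData n) (h : Hex n) : Prop :=
  ∀ i, hexX C h i = 0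

def hexWt {n : ℕ} [NeZero n] (C : CommData n) (x y : GridState n) (h : Hex n) : Rng n :=
  (∏ i : ZMod n, Vv i ^ (hexO C h i).toNat) * vV ^ m4 x y h.rect

/-- the hexagon-counting map `H• : GC•(𝔾₄) → GC•(𝔾₄)` -/
def Hmap {n : ℕ} [NeZero n] (C : CommData n) : GC n →ₗ[Rng n] GC n :=
  basisMap fun x => ∑ y : GridState n,
    ∑ h ∈ Finset.univ.filter (fun h : Hex n =>
        IsHex C x y h ∧ normal4 h.rect ∧ hexXDisj C h),
      Finsupp.single y (hexWt C x y h)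

/-! ### Double-point enhanced grid homology -/

def cycles {n : ℕ} [NeZero n] (G : GridDiagram n) : Submodule (Rng n) (GC n) :=
  LinearMap.ker (diffB G)

def bdrIn {n : ℕ} [NeZero n] (G : GridDiagram n) : Submodule (Rng n) ↥(cycles G) :=
  Submodule.comap (cycles G).subtype (LinearMap.range (diffB G))

instance GHquotInst {n : ℕ} [NeZero n] (G : GridDiagram n) :
    HasQuotient ↥(cycles G) (Submodule (Rng n) ↥(cycles G)) :=
  Submodule.hasQuotient (R := Rng n) (M := ↥(cycles G))

/-- the double-point enhanced grid homology `GH•(𝔾)` -/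
abbrev GH {n : ℕ} [NeZero n] (G : GridDiagram n) := ↥(cycles G) ⧸ bdrIn G

/-- a homology class is homogeneous of degree `(d,s)` if it has a homogeneous
cycle representative -/
def GHhomog {n : ℕ} [NeZero n] (G : GridDiagram n) (h : GH G) (d s : ℚ) : Prop :=
  ∃ w : ↥(cycles G), (Submodule.Quotient.mk w : GH G) = h ∧ IsHomog G (w : GC n) d s

/-! ### Commutation and stabilization moves as relations on grid diagrams -/

/-- `𝔾` and `𝔾'` differ by a column commutation move -/
def IsColComm {n : ℕ} (G G' : GridDiagram n) : Prop :=
  ∃ C : CommData n, C.G = G ∧ C.G' = G'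

/-- the transposed grid diagram (exchanging the roles of rows and columns) -/
def GridDiagram.transpose {n : ℕ} (G : GridDiagram n) : GridDiagram n where
  Orow := ⇑(Equiv.ofBijective G.Orow G.hO).symm
  Xrow := ⇑(Equiv.ofBijective G.Xrow G.hX).symm
  hO := (Equiv.ofBijective G.Orow G.hO).symm.bijective
  hX := (Equiv.ofBijective G.Xrow G.hX).symm.bijective
  hOX := by
    intro i h
    apply G.hOX ((Equiv.ofBijective G.Orow G.hO).symm i)
    have h1 : G.Orow ((Equiv.ofBijective G.Orow G.hO).symm i) = i :=
      Equiv.ofBijective_apply_symm_apply G.Orow G.hO i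
    have h2 : G.Xrow ((Equiv.ofBijective G.Xrow G.hX).symm i) = i :=
      Equiv.ofBijective_apply_symm_apply G.Xrow G.hX i
    rw [h1, h, h2]

/-- `𝔾` and `𝔾'` differ by a row commutation move -/
def IsRowComm {n : ℕ} (G G' : GridDiagram n) : Prop :=
  IsColComm G.transpose G'.transpose

/-- collapse map identifying `a` and `a+1` (used to destabilize) -/
def coll {n : ℕ} (a k : ZMod (n + 1)) : ZMod n :=
  (a.val : ZMod n) + (((k - a).val - 1 : ℕ) : ZMod n)

/-- `𝔾'` is obtained from `𝔾` by a stabilization with new 2×2 block at columns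
`c', c'+1` and rows `r', r'+1`; the empty square of the block sits at the corner
selected by `(ec, er)` (east column?, north row?), and `xty` records whether the
block carries two `X`-markings (type `X:·`) or two `O`-markings (type `O:·`).
E.g. `(ec, er, xty) = (false, false, true)` is type `X:SW`, with
`O₁ = (c'+1, r'+1)`, `X₁ = (c', r'+1)`, `X₂ = (c'+1, r')`. -/
def IsStabAt {n : ℕ} (G : GridDiagram n) (G' : GridDiagram (n + 1))
    (c' r' : ZMod (n + 1)) (ec er xty : Bool) : Prop :=
  (if xty then
    G'.Orow (if ec then c' else c' + 1) = (if er then r' else r' + 1) ∧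
    G'.Xrow (if ec then c' + 1 else c') = (if er then r' else r' + 1) ∧
    G'.Xrow (if ec then c' else c' + 1) = (if er then r' + 1 else r') ∧
    G.Xrow (c'.val : ZMod n) = (r'.val : ZMod n) ∧
    G.Orow (c'.val : ZMod n) = coll r' (G'.Orow (if ec then c' + 1 else c'))
  else
    G'.Xrow (if ec then c' else c' + 1) = (if er then r' else r' + 1) ∧
    G'.Orow (if ec then c' + 1 else c') = (if er then r' else r' + 1) ∧
    G'.Orow (if ec then c' else c' + 1) = (if er then r' + 1 else r') ∧
    G.Orow (c'.val : ZMod n) = (r'.val : ZMod n) ∧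
    G.Xrow (c'.val : ZMod n) = coll r' (G'.Xrow (if ec then c' + 1 else c'))) ∧
  (∀ k : ZMod (n + 1), k ≠ c' → k ≠ c' + 1 →
    G.Orow (coll c' k) = coll r' (G'.Orow k) ∧ G.Xrow (coll c' k) = coll r' (G'.Xrow k))

/-- `𝔾'` is obtained from `𝔾` by a stabilization move of one of the standard types -/
def IsStab {n : ℕ} (G : GridDiagram n) (G' : GridDiagram (n + 1)) : Prop :=
  ∃ c' r' ec er xty, IsStabAt G G' c' r' ec er xty

/-! ### The stabilization machinery (type `X:SW`) for the 4-fold complexes -/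

/-- projection of `GC•(𝔾₄')` onto the span `I₄` of states containing the
distinguished point `c = (c'+1, r'+1)` -/
def pI {n : ℕ} (c' r' : ZMod (n + 1)) : GC (n + 1) →ₗ[Rng (n + 1)] GC (n + 1) :=
  basisMap fun x => if x (c' + 1) = r' + 1 then Finsupp.single x 1 else 0

/-- projection onto the complementary span `N₄` -/
def pN {n : ℕ} (c' r' : ZMod (n + 1)) : GC (n + 1) →ₗ[Rng (n + 1)] GC (n + 1) :=
  basisMap fun x => if x (c' + 1) = r' + 1 then 0 else Finsupp.single x 1

/-- the submodule `I₄` -/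
def Isub {n : ℕ} (c' r' : ZMod (n + 1)) : Submodule (Rng (n + 1)) (GC (n + 1)) :=
  Finsupp.supported (Rng (n + 1)) (Rng (n + 1)) {x : GridState (n + 1) | x (c' + 1) = r' + 1}

/-- the submodule `N₄` -/
def Nsub {n : ℕ} (c' r' : ZMod (n + 1)) : Submodule (Rng (n + 1)) (GC (n + 1)) :=
  Finsupp.supported (Rng (n + 1)) (Rng (n + 1)) {x : GridState (n + 1) | x (c' + 1) ≠ r' + 1}

/-- the components `∂_{I₄}^{I₄}`, `∂_{I₄}^{N₄}`, `∂_{N₄}^{N₄}` of `∂₄•` -/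
def dII {n : ℕ} [NeZero (n + 1)] (G' : GridDiagram (n + 1)) (c' r' : ZMod (n + 1)) :
    GC (n + 1) →ₗ[Rng (n + 1)] GC (n + 1) :=
  pI c' r' ∘ₗ diff4 G' ∘ₗ pI c' r'

def dIN {n : ℕ} [NeZero (n + 1)] (G' : GridDiagram (n + 1)) (c' r' : ZMod (n + 1)) :
    GC (n + 1) →ₗ[Rng (n + 1)] GC (n + 1) :=
  pN c' r' ∘ₗ diff4 G' ∘ₗ pI c' r'

def dNN {n : ℕ} [NeZero (n + 1)] (G' : GridDiagram (n + 1)) (c' r' : ZMod (n + 1)) :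
    GC (n + 1) →ₗ[Rng (n + 1)] GC (n + 1) :=
  pN c' r' ∘ₗ diff4 G' ∘ₗ pN c' r'

/-- section of the column collapse map, avoiding the new column `c'+1` -/
def sect {n : ℕ} (a : ZMod (n + 1)) (k : ZMod n) : ZMod (n + 1) :=
  a + (if k - (a.val : ZMod n) = 0 then 0
       else (((k - (a.val : ZMod n)).val + 1 : ℕ) : ZMod (n + 1)))

def stCollFun {n : ℕ} (c' r' : ZMod (n + 1)) (x : GridState (n + 1)) :
    ZMod n → ZMod n :=
  fun k => coll r' (x (sect c' k))

/-- the destabilized grid state `x` corresponding to `x' = x ∪ {c}` -/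
def stColl {n : ℕ} (c' r' : ZMod (n + 1)) (x : GridState (n + 1)) : GridState n :=
  if h : Function.Bijective (stCollFun c' r' x) then Equiv.ofBijective _ h else 1

/-- the promoted module `GC•(𝔾₄)[V₁]`: the free `𝔽[V₁,…,V_n,v]`-module on the
grid states of the destabilized diagram -/
abbrev GCP (n : ℕ) := GridState n →₀ Rng (n + 1)

def basisMapP {n : ℕ} (f : GridState n → GCP n) : GCP n →ₗ[Rng (n + 1)] GCP n :=
  Finsupp.lsum (Rng (n + 1)) fun x => LinearMap.toSpanSingleton (Rng (n + 1)) (GCP n) (f x)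

/-- the identification `e₄` (extended by zero on `N₄`) -/
def e4map {n : ℕ} (c' r' : ZMod (n + 1)) : GC (n + 1) →ₗ[Rng (n + 1)] GCP n :=
  Finsupp.lsum (Rng (n + 1)) fun x =>
    LinearMap.toSpanSingleton (Rng (n + 1)) (GCP n)
      (if x (c' + 1) = r' + 1 then Finsupp.single (stColl c' r' x) (1 : Rng (n + 1)) else 0)

/-- renaming of the variables of the destabilized diagram into those of `𝔾'` -/
def renUp {n : ℕ} (c' : ZMod (n + 1)) : Rng n →+* Rng (n + 1) :=
  (MvPolynomial.rename (Option.map (sect c')) :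
      MvPolynomial (Option (ZMod n)) F →ₐ[F] MvPolynomial (Option (ZMod (n + 1))) F).toRingHom

/-- the differential of the promoted complex `GC•(𝔾₄)[V₁]` -/
def diffP {n : ℕ} [NeZero n] (G : GridDiagram n) (c' : ZMod (n + 1)) :
    GCP n →ₗ[Rng (n + 1)] GCP n :=
  basisMapP fun x => ∑ y : GridState n,
    ∑ r ∈ Finset.univ.filter
        (fun r : Rect (2 * n) => IsRect4From x y r ∧ normal4 r ∧ XDisjoint4 G r),
      Finsupp.single y (renUp c' (wt4 G x y r))

/-- homogeneity on the promoted complex -/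
def IsHomogP {n : ℕ} [NeZero n] (G : GridDiagram n) (z : GCP n) (d s : ℚ) : Prop :=
  ∀ (y : GridState n) (k : Option (ZMod (n + 1)) →₀ ℕ), MvPolynomial.coeff k (z y) ≠ 0 →
    (MaslovO G y - 2 * ∑ i : ZMod (n + 1), (k (some i) : ℚ) + 2 * (k none : ℚ) = d) ∧
    (Alex G y - ∑ i : ZMod (n + 1), (k (some i) : ℚ) = s)

/-- the map counting equivalence classes of rectangles crossing `X₂` (the
`X`-marking of column `c'+1`) once and no other `X`-marking -/
def HX2map {n : ℕ} (G' : GridDiagram (n + 1)) (c' : ZMod (n + 1)) :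
    GC (n + 1) →ₗ[Rng (n + 1)] GC (n + 1) :=
  basisMap fun x => ∑ y : GridState (n + 1),
    ∑ r ∈ Finset.univ.filter (fun r : Rect (2 * (n + 1)) =>
        IsRect4From x y r ∧ normal4 r ∧ X4count G' r (c' + 1) = 1 ∧
        ∀ k, k ≠ c' + 1 → X4count G' r k = 0),
      Finsupp.single y (wt4 G' x y r)

/-- its component `𝓗_{X₂}^{I₄} : N₄ → I₄` -/
def hX2I {n : ℕ} (G' : GridDiagram (n + 1)) (c' r' : ZMod (n + 1)) :
    GC (n + 1) →ₗ[Rng (n + 1)] GC (n + 1) :=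
  pI c' r' ∘ₗ HX2map G' c' ∘ₗ pN c' r'

/-- weight with the variable `V_j` evaluated at `1` -/
def wtNo {n : ℕ} [NeZero n] (G : GridDiagram n) (x y : GridState n) (j : ZMod n)
    (r : Rect (2 * n)) : Rng n :=
  (∏ i ∈ Finset.univ.erase j, Vv i ^ O4count G r i) * vV ^ m4 x y r

/-- `𝓗_{O₁}•`: counts `X`-disjoint rectangles crossing `O₁` (the `O`-marking of
column `c'+1`) once, with `V₁` evaluated at `1` -/
def HO1map {n : ℕ} (G' : GridDiagram (n + 1)) (c' : ZMod (n + 1)) :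
    GC (n + 1) →ₗ[Rng (n + 1)] GC (n + 1) :=
  basisMap fun x => ∑ y : GridState (n + 1),
    ∑ r ∈ Finset.univ.filter (fun r : Rect (2 * (n + 1)) =>
        IsRect4From x y r ∧ normal4 r ∧ XDisjoint4 G' r ∧ O4count G' r (c' + 1) = 1),
      Finsupp.single y (wtNo G' x y (c' + 1) r)

/-- its component `I₄ → N₄` -/
def hO1N {n : ℕ} (G' : GridDiagram (n + 1)) (c' r' : ZMod (n + 1)) :
    GC (n + 1) →ₗ[Rng (n + 1)] GC (n + 1) :=
  pN c' r' ∘ₗ HO1map G' c' ∘ₗ pI c' r'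

/-! ### Grid diagrams of arbitrary size, and the moves of Cromwell's theorem -/

/-- a grid diagram of unspecified (positive) grid number -/
structure GDS where
  sz : ℕ+
  D : GridDiagram (sz : ℕ)

instance (p : ℕ+) : NeZero (p : ℕ) := ⟨p.ne_zero⟩

/-- a single commutation or stabilization move -/
def MoveRel (A B : GDS) : Prop :=
  (∃ h : (A.sz : ℕ) = (B.sz : ℕ),
      IsColComm (h ▸ A.D) B.D ∨ IsRowComm (h ▸ A.D) B.D) ∨
  (∃ h : (B.sz : ℕ) = (A.sz : ℕ) + 1, IsStab A.D (h ▸ B.D))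

/-- connected by a finite sequence of commutation moves and
stabilization/destabilization moves -/
def ConnectedByMoves (A B : GDS) : Prop :=
  Relation.ReflTransGen (fun X Y => MoveRel X Y ∨ MoveRel Y X) A B

/-! ### Auxiliary lemmas for the grading formulas -/

theorem val_sub_one_cases {m : ℕ} [NeZero m] (q : ZMod m) :
    (q = 0 ∧ q.val = 0 ∧ (q - 1).val = m - 1) ∨
      (q ≠ 0 ∧ 0 < q.val ∧ (q - 1).val = q.val - 1) := by
  by_cases h : q = 0
  · left
    subst h
    obtain ⟨k, rfl⟩ : ∃ k, m = k + 1 := ⟨m - 1, by have := NeZero.ne m; omega⟩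
    refine ⟨rfl, ZMod.val_zero, ?_⟩
    rw [zero_sub, ZMod.val_neg_one]
    rfl
  · right
    have hp : 0 < q.val := Nat.pos_of_ne_zero fun h0 => h ((ZMod.val_eq_zero q).1 h0)
    refine ⟨h, hp, ?_⟩
    have hm : 1 < m := lt_of_le_of_lt hp (ZMod.val_lt q)
    have : Fact (1 < m) := ⟨hm⟩
    rw [ZMod.val_sub (by rw [ZMod.val_one]; exact hp), ZMod.val_one]

/-- indicator of a cyclic interval -/
def icoInd {m : ℕ} (u v k : ZMod m) : ℚ := if (k - u).val < (v - u).val then 1 else 0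

theorem icoInd_diff {m : ℕ} [NeZero m] (u v k : ZMod m) :
    icoInd u v k - icoInd u v (k - 1) = (if k = u then 1 else 0) - (if k = v then 1 else 0) := by
  unfold icoInd
  have e1 : k - 1 - u = (k - u) - 1 := by ring
  rw [e1]
  have hu : k = u ↔ (k - u).val = 0 := by rw [ZMod.val_eq_zero, sub_eq_zero]
  have hv : k = v ↔ (k - u).val = (v - u).val := by
    constructor
    · rintro rfl; rfl
    · intro h; have := ZMod.val_injective m h; exact sub_left_injective this
  have h1 := ZMod.val_lt (v - u)
  have h2 := ZMod.val_lt (k - u)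
  simp only [hu, hv]
  rcases val_sub_one_cases (k - u) with ⟨-, h3, h4⟩ | ⟨-, h3, h4⟩ <;> rw [h4] <;>
    split_ifs <;> first | omega | norm_num

/-- planar step function -/
def stepG {m : ℕ} (a b k : ZMod m) : ℚ :=
  (if a.val ≤ k.val then 1 else 0) - (if b.val ≤ k.val then 1 else 0)

theorem stepG_pred {m : ℕ} [NeZero m] (a b k : ZMod m) :
    stepG a b (k - 1) = (if a.val < k.val then 1 else 0) - (if b.val < k.val then 1 else 0) := by
  unfold stepG
  have ha := ZMod.val_lt a
  have hb := ZMod.val_lt b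
  rcases val_sub_one_cases k with ⟨-, h3, h4⟩ | ⟨-, h3, h4⟩ <;> rw [h4] <;>
    split_ifs <;> first | omega | norm_num

theorem stepG_diff {m : ℕ} [NeZero m] (a b k : ZMod m) :
    stepG a b k - stepG a b (k - 1) = (if k = a then 1 else 0) - (if k = b then 1 else 0) := by
  rw [stepG_pred]
  unfold stepG
  have ha : k = a ↔ k.val = a.val := (ZMod.val_injective m).eq_iff.symm
  have hb : k = b ↔ k.val = b.val := (ZMod.val_injective m).eq_iff.symm
  simp only [ha, hb]
  split_ifs <;> first | omega | norm_num

theorem stepG_neg {m : ℕ} (a b k : ZMod m) :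
    (if k.val < a.val then (1 : ℚ) else 0) - (if k.val < b.val then 1 else 0) = - stepG a b k := by
  unfold stepG
  split_ifs <;> first | omega | norm_num

/-- a shift invariant function is constant -/
theorem const_of_shift {m : ℕ} [NeZero m] (f : ZMod m → ℚ) (h : ∀ k, f k = f (k - 1)) (k : ZMod m) :
    f k = f 0 := by
  have : ∀ t : ℕ, f (t : ZMod m) = f 0 := by
    intro t
    induction t with
    | zero => simp
    | succ t ih => rw [h]; simpa using ih
  rw [← ZMod.natCast_zmod_val k]
  exact this _

/-- push-forward along the covering map -/
def push {n : ℕ} [NeZero n] (u v : ZMod (2 * n)) (k : ZMod n) : ℚ :=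
  ∑ p : ZMod (2 * n), if pr p = k then icoInd u v p else 0

theorem pr_sub_one {n : ℕ} (p : ZMod (2 * n)) : pr (p - 1) = pr p - 1 := by
  unfold pr; simp

theorem pr_add_n {n : ℕ} (p : ZMod (2 * n)) : pr (p + (n : ZMod (2 * n))) = pr p := by
  unfold pr; rw [map_add, map_natCast]; simp

theorem push_shift {n : ℕ} [NeZero n] (u v : ZMod (2 * n)) (k : ZMod n) :
    (∑ p : ZMod (2 * n), if pr p = k then icoInd u v (p - 1) else 0) = push u v (k - 1) := by
  unfold push
  rw [← Equiv.sum_comp (Equiv.subRight (1 : ZMod (2 * n)))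
    (fun p => if pr p = k - 1 then icoInd u v p else 0)]
  refine Finset.sum_congr rfl fun p _ => ?_
  simp [pr_sub_one]

theorem push_diff {n : ℕ} [NeZero n] (u v : ZMod (2 * n)) (k : ZMod n) :
    push u v k - push u v (k - 1)
      = (if k = pr u then 1 else 0) - (if k = pr v then 1 else 0) := by
  rw [← push_shift, push, ← Finset.sum_sub_distrib]
  have : ∀ p : ZMod (2 * n), ((if pr p = k then icoInd u v p else 0)
      - (if pr p = k then icoInd u v (p - 1) else 0))
      = (if p = u then (if k = pr u then 1 else 0) else 0)
        - (if p = v then (if k = pr v then 1 else 0) else 0) := by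
    intro p
    have h := icoInd_diff u v p
    by_cases hk : pr p = k
    · simp only [hk, if_true, h]
      have h1 : p = u → k = pr u := by rintro rfl; exact hk.symm
      have h2 : p = v → k = pr v := by rintro rfl; exact hk.symm
      split_ifs <;> simp_all
    · simp only [hk, if_false]
      have h1 : p = u → ¬ k = pr u := by rintro rfl; exact fun h => hk h.symm
      have h2 : p = v → ¬ k = pr v := by rintro rfl; exact fun h => hk h.symm
      split_ifs <;> simp_all
  simp only [this, Finset.sum_sub_distrib]
  simp

theorem push_eq {n : ℕ} [NeZero n] (u v : ZMod (2 * n)) :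
    ∃ C : ℚ, ∀ k, push u v k = stepG (pr u) (pr v) k + C := by
  refine ⟨push u v 0 - stepG (pr u) (pr v) 0, fun k => ?_⟩
  have := const_of_shift (fun k => push u v k - stepG (pr u) (pr v) k) (fun k => by
    have h1 := push_diff u v k
    have h2 := stepG_diff (pr u) (pr v) k
    linarith) k
  linarith

/-- fibrewise summation over the cover -/
theorem sum_fib {n : ℕ} [NeZero n] (w : ZMod n → ZMod n) (φ ψ : ZMod (2 * n) → ℚ) :
    (∑ p : ZMod (2 * n) × ZMod (2 * n), if w (pr p.1) = pr p.2 then φ p.1 * ψ p.2 else 0)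
      = ∑ k : ZMod n, (∑ p, if pr p = k then φ p else 0) *
          (∑ p, if pr p = w k then ψ p else 0) := by
  simp only [Finset.sum_mul_sum]
  rw [Fintype.sum_prod_type, Finset.sum_comm]
  rw [Finset.sum_comm]
  rw [Finset.sum_comm (s := (Finset.univ : Finset (ZMod n)))]
  refine Finset.sum_congr rfl fun p _ => ?_
  rw [Finset.sum_comm]
  refine Finset.sum_congr rfl fun q _ => ?_
  rw [Finset.sum_eq_single (pr p)]
  · simp [eq_comm]
  · intro k _ hk
    simp [hk.symm]
  · simp

theorem mult_eq {m : ℕ} (r : Rect m) (p : ZMod m × ZMod m) :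
    (r.mult p : ℚ) = icoInd r.cW r.cE p.1 * icoInd r.rS r.rN p.2 := by
  unfold Rect.mult icoInd inIco
  split_ifs <;> simp_all

theorem count_eq {n : ℕ} [NeZero n] (f : ZMod n → ZMod n) (r : Rect (2 * n)) :
    ∑ i : ZMod n, ((∑ p : ZMod (2 * n) × ZMod (2 * n),
      if pr p.1 = i ∧ pr p.2 = f i then r.mult p else 0 : ℕ) : ℚ)
      = ∑ k, push r.cW r.cE k * push r.rS r.rN (f k) := by
  unfold push
  rw [← sum_fib]
  push_cast
  rw [Finset.sum_comm]
  refine Finset.sum_congr rfl fun p _ => ?_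
  rw [Finset.sum_eq_single (pr p.1)]
  · simp only [mult_eq, true_and]
    simp [eq_comm]
  · intro k _ hk
    simp [hk.symm]
  · simp

theorem rpm4_eq {n : ℕ} [NeZero n] (w : GridState n) (r : Rect (2 * n)) :
    rpm4 w r = (∑ k, (push r.cW r.cE k + push r.cW r.cE (k - 1)) *
      (push r.rS r.rN (w k) + push r.rS r.rN (w k - 1))) / 4 := by
  unfold rpm4 pm4 Rect.dom4
  congr 1
  have h := sum_fib (⇑w) (fun p => icoInd r.cW r.cE p + icoInd r.cW r.cE (p - 1))
    (fun p => icoInd r.rS r.rN p + icoInd r.rS r.rN (p - 1))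
  have e : ∀ (u v : ZMod (2 * n)) (k : ZMod n),
      (∑ p, if pr p = k then icoInd u v p + icoInd u v (p - 1) else 0)
        = push u v k + push u v (k - 1) := by
    intro u v k
    rw [← push_shift, push, ← Finset.sum_add_distrib]
    refine Finset.sum_congr rfl fun p _ => ?_
    split_ifs <;> simp
  simp only [e] at h
  rw [← h]
  refine Finset.sum_congr rfl fun p _ => ?_
  split_ifs
  · push_cast
    simp only [mult_eq]
    ring
  · rfl

/-- the corner identity on the base -/
theorem corner_sum {n : ℕ} [NeZero n] {x y : GridState n} {r : Rect (2 * n)}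
    (hr : IsRect4From x y r) (Φ : ZMod n → ZMod n → ℚ) :
    ∑ k, Φ k (x k) - ∑ k, Φ k (y k)
      = Φ (pr r.cW) (pr r.rS) + Φ (pr r.cE) (pr r.rN)
        - Φ (pr r.cE) (pr r.rS) - Φ (pr r.cW) (pr r.rN) := by
  obtain ⟨-, -, -, hB⟩ := hr
  have hc : ∀ s : Rect (2 * n), ∑ p, (cornerB s p : ℚ) * Φ (pr p.1) (pr p.2)
      = Φ (pr s.cW) (pr s.rS) + Φ (pr s.cE) (pr s.rN)
        - Φ (pr s.cE) (pr s.rS) - Φ (pr s.cW) (pr s.rN) := by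
    intro s
    unfold cornerB
    push_cast
    simp only [sub_mul, add_mul, Finset.sum_sub_distrib, Finset.sum_add_distrib, ite_mul, one_mul,
      zero_mul, Finset.sum_ite_eq', Finset.sum_ite_eq, Finset.mem_univ, if_true]
    ring
  have fib2 : ∀ k : ZMod n, (∑ p : ZMod (2 * n), if pr p = k then (1 : ℚ) else 0) = 2 := by
    have hcst : ∀ k : ZMod n, (∑ p : ZMod (2 * n), if pr p = k then (1 : ℚ) else 0)
        = (∑ p : ZMod (2 * n), if pr p = 0 then (1 : ℚ) else 0) := by
      refine fun k => const_of_shift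
        (fun k => ∑ p : ZMod (2 * n), if pr p = k then (1 : ℚ) else 0) (fun k => ?_) k
      rw [← Equiv.sum_comp (Equiv.subRight (1 : ZMod (2 * n)))
        (fun p => if pr p = k - 1 then (1 : ℚ) else 0)]
      refine Finset.sum_congr rfl fun p _ => ?_
      simp [pr_sub_one]
    have htot : ∑ k : ZMod n, (∑ p : ZMod (2 * n), if pr p = k then (1 : ℚ) else 0)
        = 2 * n := by
      rw [Finset.sum_comm]
      simp [ZMod.card]
    intro k
    have hn : (n : ℚ) ≠ 0 := by exact_mod_cast NeZero.ne n
    simp only [hcst] at htot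
    simp only [Finset.sum_const, Finset.card_univ, ZMod.card, nsmul_eq_mul] at htot
    rw [hcst k]
    apply mul_left_cancel₀ hn
    linarith
  have hs : ∀ z : GridState n, ∑ p, (stInd z p : ℚ) * Φ (pr p.1) (pr p.2)
      = 4 * ∑ k, Φ k (z k) := by
    intro z
    have : ∀ p : ZMod (2 * n) × ZMod (2 * n), (stInd z p : ℚ) * Φ (pr p.1) (pr p.2)
        = if z (pr p.1) = pr p.2 then Φ (pr p.1) (z (pr p.1)) * (fun _ => (1 : ℚ)) p.2 else 0 := by
      intro p
      unfold stInd
      split_ifs with h <;> simp [h]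
    simp only [this]
    rw [sum_fib (⇑z) (fun p => Φ (pr p) (z (pr p))) (fun _ => 1), Finset.mul_sum]
    refine Finset.sum_congr rfl fun k _ => ?_
    rw [fib2]
    have : (∑ p : ZMod (2 * n), if pr p = k then Φ (pr p) (z (pr p)) else 0)
        = (∑ p : ZMod (2 * n), if pr p = k then (1 : ℚ) else 0) * Φ k (z k) := by
      rw [Finset.sum_mul]
      refine Finset.sum_congr rfl fun p _ => ?_
      split_ifs with h <;> simp [h]
    rw [this, fib2]
    ring
  have key : ∑ p, (cornerB r p : ℚ) * Φ (pr p.1) (pr p.2)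
      + ∑ p, (cornerB (trN r) p : ℚ) * Φ (pr p.1) (pr p.2)
      + ∑ p, (cornerB (trE r) p : ℚ) * Φ (pr p.1) (pr p.2)
      + ∑ p, (cornerB (trN (trE r)) p : ℚ) * Φ (pr p.1) (pr p.2)
      = ∑ p, (stInd x p : ℚ) * Φ (pr p.1) (pr p.2)
        - ∑ p, (stInd y p : ℚ) * Φ (pr p.1) (pr p.2) := by
    simp only [← Finset.sum_add_distrib, ← Finset.sum_sub_distrib]
    refine Finset.sum_congr rfl fun p _ => ?_
    have h : ((cornerB r p + cornerB (trN r) p + cornerB (trE r) p + cornerB (trN (trE r)) p : ℤ) : ℚ)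
      = ((stInd x p - stInd y p : ℤ) : ℚ) := by rw [hB p]
    push_cast at h
    rw [← sub_mul, ← h]
    ring
  simp only [hc, hs] at key
  simp only [trN, trE, pr_add_n] at key
  linarith

/-! planar counting -/

/-- the strict-order kernel -/
def ker (o o' : ℕ) {m : ℕ} (k j l i : ZMod m) : ℚ :=
  (if 2 * k.val + o < 2 * l.val + o' then 1 else 0) *
    (if 2 * j.val + o < 2 * i.val + o' then 1 else 0)

theorem Icnt_eq {m : ℕ} [NeZero m] (f g : ZMod m → ZMod m) (o o' : ℕ) :
    (Icnt (ptsOf f o) (ptsOf g o') : ℚ) = ∑ k, ∑ l, ker o o' k (f k) l (g l) := by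
  have inj : ∀ (f : ZMod m → ZMod m) (o : ℕ),
      Function.Injective fun k : ZMod m => (2 * k.val + o, 2 * (f k).val + o) := by
    intro f o k l h
    simp only [Prod.mk.injEq] at h
    exact ZMod.val_injective m (by omega)
  unfold Icnt ptsOf
  rw [Finset.sum_image fun a _ b _ h => inj f o h]
  push_cast
  refine Finset.sum_congr rfl fun k _ => ?_
  rw [Finset.card_filter, Finset.sum_image fun a _ b _ h => inj g o' h]
  push_cast
  refine Finset.sum_congr rfl fun l _ => ?_
  unfold ker
  split_ifs <;> simp_all

/-- symmetrised kernel -/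
def sker (o o' : ℕ) {m : ℕ} (k j l i : ZMod m) : ℚ :=
  (ker o o' k j l i + ker o' o l i k j) / 2

theorem Jq_eq {m : ℕ} [NeZero m] (f g : ZMod m → ZMod m) (o o' : ℕ) :
    Jq (ptsOf f o) (ptsOf g o') = ∑ l, ∑ k, sker o o' k (f k) l (g l) := by
  unfold Jq sker
  rw [Icnt_eq, Icnt_eq, Finset.sum_comm, ← Finset.sum_add_distrib, Finset.sum_div]
  refine Finset.sum_congr rfl fun l _ => ?_
  rw [← Finset.sum_add_distrib, Finset.sum_div]

theorem Jq_symm (P Q : Finset (ℕ × ℕ)) : Jq P Q = Jq Q P := by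
  unfold Jq; rw [add_comm]

theorem Jdiff_state {n : ℕ} [NeZero n] {x y : GridState n} {r : Rect (2 * n)}
    (hr : IsRect4From x y r) (w : ZMod n → ZMod n) :
    Jq (ptsOf (⇑x) 0) (ptsOf w 0) - Jq (ptsOf (⇑y) 0) (ptsOf w 0)
      = ∑ k, (stepG (pr r.cW) (pr r.cE) (k - 1) * stepG (pr r.rS) (pr r.rN) (w k - 1)
          + stepG (pr r.cW) (pr r.cE) k * stepG (pr r.rS) (pr r.rN) (w k)) / 2 := by
  rw [Jq_eq, Jq_eq, ← Finset.sum_sub_distrib]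
  refine Finset.sum_congr rfl fun l _ => ?_
  rw [corner_sum hr (fun k j => sker 0 0 k j l (w l)), stepG_pred, stepG_pred,
    ← neg_mul_neg (stepG (pr r.cW) (pr r.cE) l), ← stepG_neg, ← stepG_neg]
  simp only [sker, ker, add_zero, Nat.mul_lt_mul_left (show 0 < 2 by norm_num)]
  ring

theorem Jdiff_mark {n : ℕ} [NeZero n] {x y : GridState n} {r : Rect (2 * n)}
    (hr : IsRect4From x y r) (w : ZMod n → ZMod n) :
    Jq (ptsOf (⇑x) 0) (ptsOf w 1) - Jq (ptsOf (⇑y) 0) (ptsOf w 1)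
      = ∑ k, stepG (pr r.cW) (pr r.cE) k * stepG (pr r.rS) (pr r.rN) (w k) := by
  rw [Jq_eq, Jq_eq, ← Finset.sum_sub_distrib]
  refine Finset.sum_congr rfl fun l _ => ?_
  rw [corner_sum hr (fun k j => sker 0 1 k j l (w l))]
  have h1 : ∀ a b : ℕ, (2 * a + 0 < 2 * b + 1) ↔ a ≤ b := by intros; omega
  have h2 : ∀ a b : ℕ, (2 * a + 1 < 2 * b + 0) ↔ a < b := by intros; omega
  simp only [sker, ker, h1, h2]
  have n1 := stepG_neg (pr r.cW) (pr r.cE) l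
  have n2 := stepG_neg (pr r.rS) (pr r.rN) (w l)
  have n3 := congrArg₂ (· * ·) n1 n2
  simp only [stepG] at n3 ⊢
  linear_combination n3 / 2

/-- invariance of the correction term under adding full rows and columns -/
theorem F_inv {n : ℕ} [NeZero n] (x y : GridState n) (f : ZMod n → ZMod n)
    (hf : Function.Bijective f) (φ ψ : ZMod n → ℚ) (C D : ℚ) :
    (∑ k, ((φ k + C) + (φ (k - 1) + C)) * ((ψ (x k) + D) + (ψ (x k - 1) + D))) / 4
      + (∑ k, ((φ k + C) + (φ (k - 1) + C)) * ((ψ (y k) + D) + (ψ (y k - 1) + D))) / 4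
      - 2 * ∑ k, (φ k + C) * (ψ (f k) + D)
    = (∑ k, (φ k + φ (k - 1)) * (ψ (x k) + ψ (x k - 1))) / 4
      + (∑ k, (φ k + φ (k - 1)) * (ψ (y k) + ψ (y k - 1))) / 4
      - 2 * ∑ k, φ k * ψ (f k) := by
  have sh : ∀ g : ZMod n → ℚ, ∑ k, g (k - 1) = ∑ k, g k := fun g =>
    Equiv.sum_comp (Equiv.subRight (1 : ZMod n)) g
  have hw : ∀ w : GridState n,
      ∑ k, ((φ k + C) + (φ (k - 1) + C)) * ((ψ (w k) + D) + (ψ (w k - 1) + D))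
      = ∑ k, (φ k + φ (k - 1)) * (ψ (w k) + ψ (w k - 1))
        + 4 * D * ∑ k, φ k + 4 * C * ∑ k, ψ k + 4 * C * D * n := by
    intro w
    have e : ∀ k, ((φ k + C) + (φ (k - 1) + C)) * ((ψ (w k) + D) + (ψ (w k - 1) + D))
        = (φ k + φ (k - 1)) * (ψ (w k) + ψ (w k - 1))
          + (2 * D * φ k + 2 * D * φ (k - 1)) + (2 * C * ψ (w k) + 2 * C * ψ (w k - 1))
          + 4 * C * D := by intro k; ring
    simp only [e, Finset.sum_add_distrib, ← Finset.mul_sum]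
    rw [sh φ, Equiv.sum_comp w ψ, Equiv.sum_comp w (fun j => ψ (j - 1)), sh ψ]
    simp [ZMod.card]
    ring
  have ho : ∑ k, (φ k + C) * (ψ (f k) + D)
      = ∑ k, φ k * ψ (f k) + D * ∑ k, φ k + C * ∑ k, ψ k + C * D * n := by
    have e : ∀ k, (φ k + C) * (ψ (f k) + D)
        = φ k * ψ (f k) + D * φ k + C * ψ (f k) + C * D := by intro k; ring
    simp only [e, Finset.sum_add_distrib, ← Finset.mul_sum]
    rw [hf.sum_comp ψ]
    simp [ZMod.card]
    ring
  rw [hw x, hw y, ho]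
  ring

theorem diag_zero {n : ℕ} [NeZero n] {x y : GridState n} {r : Rect (2 * n)}
    (hr : IsRect4From x y r) :
    ∑ k, (stepG (pr r.cW) (pr r.cE) k - stepG (pr r.cW) (pr r.cE) (k - 1)) *
        (stepG (pr r.rS) (pr r.rN) (x k) - stepG (pr r.rS) (pr r.rN) (x k - 1))
    + ∑ k, (stepG (pr r.cW) (pr r.cE) k - stepG (pr r.cW) (pr r.cE) (k - 1)) *
        (stepG (pr r.rS) (pr r.rN) (y k) - stepG (pr r.rS) (pr r.rN) (y k - 1)) = 0 := by
  simp only [stepG_diff]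
  have e : ∀ w : GridState n, ∑ k, ((if k = pr r.cW then (1 : ℚ) else 0) - if k = pr r.cE then 1 else 0) *
      ((if w k = pr r.rS then 1 else 0) - if w k = pr r.rN then 1 else 0)
      = ∑ k, (if w k = x k then (1 : ℚ) else 0) - ∑ k, (if w k = y k then (1 : ℚ) else 0) := by
    intro w
    rw [corner_sum hr (fun k j => if w k = j then (1 : ℚ) else 0)]
    simp only [sub_mul, Finset.sum_sub_distrib, ite_mul, one_mul, zero_mul,
      Finset.sum_ite_eq', Finset.mem_univ, if_true]
    ring
  rw [e x, e y]
  simp only [eq_comm (a := x _) (b := y _), if_true]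
  ring

theorem maslov_diff {n : ℕ} [NeZero n] {x y : GridState n} {r : Rect (2 * n)}
    (hr : IsRect4From x y r) (f : ZMod n → ZMod n) (hf : Function.Bijective f) :
    MaslovOf f x - MaslovOf f y
      = rpm4 x r + rpm4 y r - 2 * ∑ k, push r.cW r.cE k * push r.rS r.rN (f k) := by
  obtain ⟨C, hC⟩ := push_eq r.cW r.cE
  obtain ⟨D, hD⟩ := push_eq r.rS r.rN
  rw [rpm4_eq, rpm4_eq]
  simp only [hC, hD]
  rw [F_inv x y f hf]
  have d := diag_zero hr
  have jx := Jdiff_state hr (⇑x)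
  have jy := Jdiff_state hr (⇑y)
  have jf := Jdiff_mark hr f
  have s := Jq_symm (ptsOf (⇑x) 0) (ptsOf (⇑y) 0)
  have e : ∀ w : GridState n,
      (∑ k, (stepG (pr r.cW) (pr r.cE) k + stepG (pr r.cW) (pr r.cE) (k - 1)) *
        (stepG (pr r.rS) (pr r.rN) (w k) + stepG (pr r.rS) (pr r.rN) (w k - 1))) / 4
      = ∑ k, (stepG (pr r.cW) (pr r.cE) (k - 1) * stepG (pr r.rS) (pr r.rN) (w k - 1)
          + stepG (pr r.cW) (pr r.cE) k * stepG (pr r.rS) (pr r.rN) (w k)) / 2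
        - (∑ k, (stepG (pr r.cW) (pr r.cE) k - stepG (pr r.cW) (pr r.cE) (k - 1)) *
        (stepG (pr r.rS) (pr r.rN) (w k) - stepG (pr r.rS) (pr r.rN) (w k - 1))) / 4 := by
    intro w
    simp only [Finset.sum_div]
    rw [← Finset.sum_sub_distrib]
    refine Finset.sum_congr rfl fun k _ => ?_
    ring
  rw [e x, e y, ← jx, ← jy, ← jf]
  unfold MaslovOf
  linarith

/-- grading formulas.  For any grid states `x₄, y₄` of `𝔾₄` and
any `[r₄] ∈ [Rect](x₄, y₄)`:
`M(x₄) − M(y₄) = 1 − 2·Σᵢ O_i[r₄] + 2·m[r₄]` and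
`A(x₄) − A(y₄) = Σᵢ X_i[r₄] − Σᵢ O_i[r₄]`. -/
theorem statement1 (n : ℕ) [NeZero n] (G : GridDiagram n) (x y : GridState n)
    (r : Rect (2 * n)) (hr : IsRect4From x y r) :
    MaslovO G x - MaslovO G y
        = 1 - 2 * (∑ i : ZMod n, (O4count G r i : ℚ)) + 2 * mQ4 x y r ∧
    Alex G x - Alex G y
        = (∑ i : ZMod n, (X4count G r i : ℚ)) - ∑ i : ZMod n, (O4count G r i : ℚ) := by
  have hO := maslov_diff hr G.Orow G.hO
  have hX := maslov_diff hr G.Xrow G.hX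
  rw [← count_eq] at hO hX
  constructor
  · unfold MaslovO mQ4 O4count
    rw [hO]
    ring
  · unfold Alex MaslovO MaslovX O4count X4count
    linarith

end GridHomology
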